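/- Fix an integer N ≥ 2 and integers k_1, k_2 with 1 ≤ k_1 < k_2 ≤ N − 1. The centroids C_{k_1,N} and C_{k_2,N} of the k_1- and k_2-skeletons of the standard simplex in ℝ^N are equal if and only if there exist positive integers a and b with k_1 = a² − 1, k_2 = b² − 1, and N = (b² + ab + a²) − (b + a) − 1. -/

import Mathlib

open MeasureTheory

/-- The vertices of the standard simplex in `ℝ^N`: the origin together with the standard
basis vectors `e_1, …, e_N`. -/
noncomputable def simplexVertex (N : ℕ) (i : Fin (N + 1)) : EuclideanSpace ℝ (Fin N) :=
  if h : i = 0 then 0 else EuclideanSpace.single (i.pred h) 1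

/-- The `k`-skeleton of the standard simplex in `ℝ^N`: the union of the convex hulls of
all `(k+1)`-element subsets of the vertex set `{0, e_1, …, e_N}`. -/
def simplexSkeleton (N k : ℕ) : Set (EuclideanSpace ℝ (Fin N)) :=
  ⋃ s ∈ {s : Finset (Fin (N + 1)) | s.card = k + 1}, convexHull ℝ (simplexVertex N '' ↑s)

/-- The centroid `C_{k,N}` of the `k`-skeleton of the standard simplex in `ℝ^N`: the
vector-valued integral of the identity over the skeleton with respect to `k`-dimensional
Hausdorff measure, divided by the total `k`-dimensional Hausdorff measure of the
skeleton. -/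
noncomputable def skeletonCentroid (N k : ℕ) : EuclideanSpace ℝ (Fin N) :=
  (μH[(k : ℝ)] (simplexSkeleton N k)).toReal⁻¹ •
    ∫ x in simplexSkeleton N k, x ∂(μH[(k : ℝ)])

/-- The barycentric coordinates of a point of `ℝ^N` with respect to the vertices of the
standard simplex. -/
noncomputable def baryCoord {N : ℕ} (x : EuclideanSpace ℝ (Fin N)) : Fin (N + 1) → ℝ :=
  Fin.cons (1 - ∑ j, x j) (fun j => x j)

/-- The face of the standard simplex spanned by a set of vertices, in barycentric
coordinates. -/
def simplexFace (N : ℕ) (s : Finset (Fin (N + 1))) : Set (EuclideanSpace ℝ (Fin N)) :=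
  {x | ∀ i, 0 ≤ baryCoord x i ∧ (i ∉ s → baryCoord x i = 0)}

@[simp]
theorem baryCoord_zero {N : ℕ} (x : EuclideanSpace ℝ (Fin N)) :
    baryCoord x 0 = 1 - ∑ j, x j := rfl

@[simp]
theorem baryCoord_succ {N : ℕ} (x : EuclideanSpace ℝ (Fin N)) (j : Fin N) :
    baryCoord x j.succ = x j := rfl

theorem sum_baryCoord {N : ℕ} (x : EuclideanSpace ℝ (Fin N)) : ∑ i, baryCoord x i = 1 := by
  simp [Fin.sum_univ_succ]

theorem continuous_baryCoord {N : ℕ} (i : Fin (N + 1)) :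
    Continuous fun x : EuclideanSpace ℝ (Fin N) => baryCoord x i := by
  refine Fin.cases ?_ (fun j => ?_) i
  · simp only [baryCoord_zero]; fun_prop
  · simp only [baryCoord_succ]; fun_prop

theorem baryCoord_toLp {N : ℕ} {w : Fin (N + 1) → ℝ} (hw : ∑ i, w i = 1) :
    baryCoord (WithLp.toLp 2 fun j : Fin N => w j.succ) = w := by
  ext i
  refine Fin.cases ?_ (fun j => ?_) i
  · rw [Fin.sum_univ_succ] at hw
    simp only [baryCoord_zero]
    linarith
  · simp

theorem baryCoord_injective {N : ℕ} :
    Function.Injective (baryCoord : EuclideanSpace ℝ (Fin N) → _) := by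
  intro x y h
  ext j
  simpa using congrFun h j.succ

theorem baryCoord_add_smul {N : ℕ} (x y : EuclideanSpace ℝ (Fin N)) {a b : ℝ} (hab : a + b = 1)
    (i : Fin (N + 1)) :
    baryCoord (a • x + b • y) i = a * baryCoord x i + b * baryCoord y i := by
  refine Fin.cases ?_ (fun j => ?_) i
  · simp only [baryCoord_zero, PiLp.add_apply, PiLp.smul_apply, smul_eq_mul,
      Finset.sum_add_distrib, ← Finset.mul_sum]
    linear_combination -hab
  · simp

theorem baryCoord_simplexVertex {N : ℕ} (i m : Fin (N + 1)) :
    baryCoord (simplexVertex N i) m = if m = i then 1 else 0 := by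
  refine Fin.cases ?_ (fun i => ?_) i <;> refine Fin.cases ?_ (fun m => ?_) m <;>
    simp [simplexVertex, Fin.succ_ne_zero, (Fin.succ_ne_zero _).symm]

theorem sum_baryCoord_smul_simplexVertex {N : ℕ} (x : EuclideanSpace ℝ (Fin N)) :
    ∑ i, baryCoord x i • simplexVertex N i = x := by
  rw [Fin.sum_univ_succ]
  ext j
  simp [simplexVertex, Fin.succ_ne_zero, Pi.single_apply]

theorem convexHull_simplexVertex {N : ℕ} (s : Finset (Fin (N + 1))) :
    convexHull ℝ (simplexVertex N '' ↑s) = simplexFace N s := by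
  apply subset_antisymm
  · apply convexHull_min
    · rintro _ ⟨i, hi, rfl⟩ m
      rw [baryCoord_simplexVertex]
      split_ifs with h
      · subst h
        exact ⟨zero_le_one, fun h => absurd hi h⟩
      · simp
    · intro x hx y hy a b ha hb hab i
      rw [baryCoord_add_smul x y hab]
      refine ⟨add_nonneg (mul_nonneg ha (hx i).1) (mul_nonneg hb (hy i).1), fun h => ?_⟩
      rw [(hx i).2 h, (hy i).2 h]
      simp
  · intro x hx
    have h1 : ∑ i ∈ s, baryCoord x i = 1 := by
      rw [← sum_baryCoord x]
      exact Finset.sum_subset (Finset.subset_univ s) fun i _ hi => (hx i).2 hi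
    have h2 : ∑ i ∈ s, baryCoord x i • simplexVertex N i = x := by
      conv_rhs => rw [← sum_baryCoord_smul_simplexVertex x]
      exact Finset.sum_subset (Finset.subset_univ s) fun i _ hi => by rw [(hx i).2 hi, zero_smul]
    rw [← h2]
    exact (convex_convexHull ℝ _).sum_mem (fun i _ => (hx i).1) h1 fun i hi =>
      subset_convexHull ℝ _ ⟨i, hi, rfl⟩

theorem isCompact_simplexFace {N : ℕ} (s : Finset (Fin (N + 1))) :
    IsCompact (simplexFace N s) := by
  rw [← convexHull_simplexVertex]
  exact (s.finite_toSet.image _).isCompact_convexHull ℝ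

theorem simplexSkeleton_eq_iUnion (N k : ℕ) :
    simplexSkeleton N k =
      ⋃ s : Finset.powersetCard (k + 1) (Finset.univ : Finset (Fin (N + 1))),
        simplexFace N (s : Finset (Fin (N + 1))) := by
  ext x
  simp [simplexSkeleton, convexHull_simplexVertex]

/-- The affine parametrization of a face by the standard simplex of the same dimension, sending
the `i`-th vertex to the `p i`-th vertex. -/
noncomputable def faceMap {k N : ℕ} (p : Fin (k + 1) → Fin (N + 1))
    (x : EuclideanSpace ℝ (Fin k)) : EuclideanSpace ℝ (Fin N) :=
  WithLp.toLp 2 fun j : Fin N => Function.extend p (baryCoord x) 0 j.succ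

section FaceMap

variable {k N : ℕ} {p : Fin (k + 1) → Fin (N + 1)}

theorem baryCoord_faceMap (hp : Function.Injective p)
    (x : EuclideanSpace ℝ (Fin k)) :
    baryCoord (faceMap p x) = Function.extend p (baryCoord x) 0 := by
  apply baryCoord_toLp
  rw [← sum_baryCoord x]
  refine (Fintype.sum_of_injective p hp _ _ (fun i hi => ?_) fun i => ?_).symm
  · rw [Function.extend_apply' _ _ _ (by simpa using hi)]; rfl
  · rw [hp.extend_apply]

theorem baryCoord_faceMap_apply (hp : Function.Injective p)
    (x : EuclideanSpace ℝ (Fin k)) (i : Fin (k + 1)) :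
    baryCoord (faceMap p x) (p i) = baryCoord x i := by
  rw [baryCoord_faceMap hp, hp.extend_apply]

theorem baryCoord_faceMap_of_notMem (hp : Function.Injective p)
    (x : EuclideanSpace ℝ (Fin k)) {m : Fin (N + 1)}
    (hm : m ∉ Set.range p) : baryCoord (faceMap p x) m = 0 := by
  rw [baryCoord_faceMap hp, Function.extend_apply' _ _ _ (by simpa using hm)]; rfl

theorem faceMap_preimage_simplexFace (hp : Function.Injective p)
    {s : Finset (Fin (N + 1))} (hs : Set.range p = s) :
    faceMap p ⁻¹' simplexFace N s = simplexFace k Finset.univ := by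
  ext x
  constructor
  · intro h i
    rw [← baryCoord_faceMap_apply hp]
    exact ⟨(h (p i)).1, fun hi => absurd (Finset.mem_univ i) hi⟩
  · intro h m
    by_cases hm : m ∈ Set.range p
    · obtain ⟨i, rfl⟩ := hm
      rw [baryCoord_faceMap_apply hp]
      exact ⟨(h i).1, fun hi => absurd (Finset.mem_coe.1 (hs ▸ Set.mem_range_self i)) hi⟩
    · simp [baryCoord_faceMap_of_notMem hp x hm]

theorem simplexFace_subset_range_faceMap (hp : Function.Injective p)
    {s : Finset (Fin (N + 1))} (hs : Set.range p = s) :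
    simplexFace N s ⊆ Set.range (faceMap p) := by
  intro y hy
  have hsum : ∑ i, baryCoord y (p i) = 1 := by
    rw [← sum_baryCoord y]
    refine Fintype.sum_of_injective p hp _ _ (fun i hi => (hy i).2 ?_) fun i => rfl
    rwa [← Finset.mem_coe, ← hs]
  refine ⟨WithLp.toLp 2 fun j => baryCoord y (p j.succ), baryCoord_injective ?_⟩
  ext m
  by_cases hm : m ∈ Set.range p
  · obtain ⟨i, rfl⟩ := hm
    rw [baryCoord_faceMap_apply hp, baryCoord_toLp (w := fun i => baryCoord y (p i)) hsum]
  · rw [baryCoord_faceMap_of_notMem hp _ hm, (hy m).2]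
    rwa [← Finset.mem_coe, ← hs]

theorem dist_faceMap_sq (hp : Function.Injective p)
    (x y : EuclideanSpace ℝ (Fin k)) :
    (baryCoord (faceMap p x) 0 - baryCoord (faceMap p y) 0) ^ 2 +
        dist (faceMap p x) (faceMap p y) ^ 2 =
      (∑ j, (x j - y j)) ^ 2 + dist x y ^ 2 := by
  have key : ∑ m, (baryCoord (faceMap p x) m - baryCoord (faceMap p y) m) ^ 2 =
      ∑ i, (baryCoord x i - baryCoord y i) ^ 2 := by
    refine (Fintype.sum_of_injective p hp _ _ (fun i hi => ?_) fun i => ?_).symm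
    · simp [baryCoord_faceMap_of_notMem hp _ hi]
    · simp [baryCoord_faceMap_apply hp]
  rw [Fin.sum_univ_succ, Fin.sum_univ_succ] at key
  simp only [EuclideanSpace.dist_eq, Real.dist_eq, sq_abs,
    Real.sq_sqrt (Finset.sum_nonneg fun _ _ => sq_nonneg _)]
  simp only [baryCoord_succ] at key
  rw [key]
  simp only [baryCoord_zero, Finset.sum_sub_distrib]
  ring

end FaceMap

section Measure

variable {k : ℕ}

instance isAddHaarMeasure_hausdorffMeasure_euclideanSpace :
    (μH[(k : ℝ)] : Measure (EuclideanSpace ℝ (Fin k))).IsAddHaarMeasure := by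
  have h := isAddHaarMeasure_hausdorffMeasure (E := EuclideanSpace ℝ (Fin k))
  rwa [finrank_euclideanSpace_fin] at h

/-- If `f` distorts distances as the linear automorphism `L` does, then it distorts
the `k`-dimensional Hausdorff measure by `|det L|`. -/
theorem hausdorffMeasure_restrict_range {F : Type*} [MetricSpace F] [MeasurableSpace F]
    [BorelSpace F] (f : EuclideanSpace ℝ (Fin k) → F)
    (L : EuclideanSpace ℝ (Fin k) →ₗ[ℝ] EuclideanSpace ℝ (Fin k)) (hL : LinearMap.det L ≠ 0)
    (hf : ∀ x y, dist (f x) (f y) = dist (L x) (L y)) :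
    Topology.IsClosedEmbedding f ∧
      (μH[(k : ℝ)] : Measure F).restrict (Set.range f) =
        ENNReal.ofReal |LinearMap.det L| • Measure.map f μH[(k : ℝ)] := by
  let e := L.equivOfDetNeZero hL
  have he : ∀ x, e x = L x := fun x => rfl
  let g : EuclideanSpace ℝ (Fin k) → F := f ∘ e.symm
  have hg : Isometry g := Isometry.of_dist_eq fun x y => by
    simp only [g, Function.comp, hf, ← he, LinearEquiv.apply_symm_apply]
  have hfg : f = g ∘ L := by
    ext x
    simp [g, ← he]
  have hec : Topology.IsClosedEmbedding L :=
    e.toContinuousLinearEquiv.toHomeomorph.isClosedEmbedding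
  refine ⟨hfg ▸ hg.isClosedEmbedding.comp hec, ?_⟩
  have hr : Set.range f = Set.range g := by
    rw [hfg]
    exact (e.surjective.range_comp g)
  rw [hr, ← hg.map_hausdorffMeasure (Or.inl k.cast_nonneg), hfg,
    ← Measure.map_map hg.continuous.measurable hec.continuous.measurable,
    Measure.map_linearMap_addHaar_eq_smul_addHaar _ hL, Measure.map_smul, smul_smul,
    ← ENNReal.ofReal_mul (abs_nonneg _), ← abs_mul, mul_inv_cancel₀ hL]
  simp

/-- The linear map `x ↦ x + c (∑ x_j) (1, …, 1)`. -/
noncomputable def diagonalShear (k : ℕ) (c : ℝ) :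
    EuclideanSpace ℝ (Fin k) →ₗ[ℝ] EuclideanSpace ℝ (Fin k) :=
  Matrix.toLpLin 2 2
    (1 + Matrix.replicateCol Unit (fun _ => c) * Matrix.replicateRow Unit (fun _ => (1 : ℝ)))

theorem diagonalShear_apply (c : ℝ) (x : EuclideanSpace ℝ (Fin k)) (i : Fin k) :
    diagonalShear k c x i = x i + c * ∑ j, x j := by
  simp only [diagonalShear, Matrix.toLpLin_apply, Matrix.add_mulVec, ← Matrix.mulVec_mulVec]
  simp [Matrix.mulVec, dotProduct, Matrix.mul_apply, Finset.mul_sum]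

theorem det_diagonalShear (c : ℝ) : LinearMap.det (diagonalShear k c) = 1 + k * c := by
  rw [diagonalShear, Matrix.toLpLin_eq_toLin, LinearMap.det_toLin,
    Matrix.det_one_add_mul_comm]
  simp [Matrix.det_unique, Matrix.mul_apply]

theorem dist_diagonalShear_sq (c : ℝ) (x y : EuclideanSpace ℝ (Fin k)) :
    dist (diagonalShear k c x) (diagonalShear k c y) ^ 2 =
      (2 * c + k * c ^ 2) * (∑ j, (x j - y j)) ^ 2 + dist x y ^ 2 := by
  simp only [EuclideanSpace.dist_eq, Real.dist_eq, sq_abs,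
    Real.sq_sqrt (Finset.sum_nonneg fun _ _ => sq_nonneg _)]
  have h : ∀ i, (diagonalShear k c x i - diagonalShear k c y i) ^ 2 =
      (x i - y i) ^ 2 + 2 * c * (∑ j, (x j - y j)) * (x i - y i) +
        c ^ 2 * (∑ j, (x j - y j)) ^ 2 := fun i => by
    rw [diagonalShear_apply, diagonalShear_apply, Finset.sum_sub_distrib]
    ring
  simp only [h, Finset.sum_add_distrib, ← Finset.mul_sum, Finset.sum_const, Finset.card_univ,
    Fintype.card_fin, nsmul_eq_mul]
  ring

theorem hausdorffMeasure_baryCoord_eq_zero (i : Fin (k + 1)) :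
    (μH[(k : ℝ)] : Measure (EuclideanSpace ℝ (Fin k))) {x | baryCoord x i = 0} = 0 := by
  let A : AffineSubspace ℝ (EuclideanSpace ℝ (Fin k)) :=
    { carrier := {x | baryCoord x i = 0}
      smul_vsub_vadd_mem' := by
        intro c x y z hx hy hz
        revert hx hy hz
        refine Fin.cases ?_ (fun j => ?_) i
        · simp only [Set.mem_ofPred_eq, baryCoord_zero, vsub_eq_sub, vadd_eq_add, PiLp.add_apply,
            PiLp.smul_apply, PiLp.sub_apply, smul_eq_mul, Finset.sum_add_distrib,
            ← Finset.mul_sum, Finset.sum_sub_distrib]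
          intro hx hy hz
          linear_combination c * hx - c * hy + hz
        · simp only [Set.mem_ofPred_eq, baryCoord_succ, vsub_eq_sub, vadd_eq_add, PiLp.add_apply,
            PiLp.smul_apply, PiLp.sub_apply, smul_eq_mul]
          intro hx hy hz
          rw [hx, hy, hz]
          ring }
  refine Measure.addHaar_affineSubspace _ A fun h => ?_
  have h1 : simplexVertex k i ∈ A := h ▸ AffineSubspace.mem_top ℝ _ _
  have h2 : baryCoord (simplexVertex k i) i = 0 := h1
  simp [baryCoord_simplexVertex] at h2

/-- The linear part of the affine involution of `ℝ^k` exchanging the origin with the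
`i`-th basis vector and fixing the other basis vectors. -/
noncomputable def swapOriginLinear (i : Fin k) :
    EuclideanSpace ℝ (Fin k) →ₗ[ℝ] EuclideanSpace ℝ (Fin k) where
  toFun x := WithLp.toLp 2 fun j => if j = i then -∑ l, x l else x j
  map_add' x y := by
    ext j
    by_cases h : j = i
    · simp only [h, PiLp.add_apply, Finset.sum_add_distrib, if_true]
      ring
    · simp [h]
  map_smul' c x := by
    ext j
    by_cases h : j = i
    · simp [h, ← Finset.mul_sum]
    · simp [h]

theorem swapOriginLinear_apply (i : Fin k) (x : EuclideanSpace ℝ (Fin k)) (j : Fin k) :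
    swapOriginLinear i x j = if j = i then -∑ l, x l else x j := rfl

theorem sum_swapOriginLinear (i : Fin k) (x : EuclideanSpace ℝ (Fin k)) :
    ∑ j, swapOriginLinear i x j = -x i := by
  have h : ∀ j, swapOriginLinear i x j = x j + if j = i then -∑ l, x l - x i else 0 := by
    intro j
    rw [swapOriginLinear_apply]
    split_ifs with h
    · rw [h]; ring
    · ring
  simp only [h, Finset.sum_add_distrib, Finset.sum_ite_eq', Finset.mem_univ, if_true]
  ring

theorem abs_det_swapOriginLinear (i : Fin k) : |LinearMap.det (swapOriginLinear i)| = 1 := by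
  have h : swapOriginLinear i ∘ₗ swapOriginLinear i = LinearMap.id := by
    ext x j
    rw [LinearMap.comp_apply, swapOriginLinear_apply, sum_swapOriginLinear]
    split_ifs with h
    · simp [h]
    · simp [swapOriginLinear_apply, h]
  have h2 := congrArg LinearMap.det h
  rw [LinearMap.det_comp, LinearMap.det_id] at h2
  rcases mul_self_eq_one_iff.1 h2 with h3 | h3 <;> simp [h3]

/-- The affine involution of `ℝ^k` exchanging the origin with the `i`-th basis vector and
fixing the other basis vectors. -/
noncomputable def swapOrigin (i : Fin k) (x : EuclideanSpace ℝ (Fin k)) :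
    EuclideanSpace ℝ (Fin k) :=
  swapOriginLinear i x + EuclideanSpace.single i 1

theorem baryCoord_swapOrigin (i : Fin k) (x : EuclideanSpace ℝ (Fin k)) (m : Fin (k + 1)) :
    baryCoord (swapOrigin i x) m = baryCoord x (Equiv.swap 0 i.succ m) := by
  refine Fin.cases ?_ (fun j => ?_) m
  · simp [swapOrigin, Finset.sum_add_distrib, sum_swapOriginLinear]
  · by_cases h : j = i
    · subst h
      simp [swapOrigin, swapOriginLinear_apply]
      ring
    · rw [Equiv.swap_apply_of_ne_of_ne (Fin.succ_ne_zero _) (by simpa using h)]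
      simp [swapOrigin, swapOriginLinear_apply, h]

theorem swapOrigin_involutive (i : Fin k) : Function.Involutive (swapOrigin i) := fun x =>
  baryCoord_injective (funext fun m => by simp [baryCoord_swapOrigin])

theorem setIntegral_baryCoord_succ (i : Fin k) :
    ∫ x in simplexFace k Finset.univ, baryCoord x i.succ ∂μH[(k : ℝ)] =
      ∫ x in simplexFace k Finset.univ, baryCoord x 0 ∂μH[(k : ℝ)] := by
  obtain ⟨he, hm⟩ := hausdorffMeasure_restrict_range (swapOrigin i) (swapOriginLinear i)
    (fun h => by simpa [h] using abs_det_swapOriginLinear i)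
    (fun x y => by simp [swapOrigin])
  rw [(swapOrigin_involutive i).surjective.range_eq, Measure.restrict_univ,
    abs_det_swapOriginLinear, ENNReal.ofReal_one, one_smul] at hm
  have hmp : MeasurePreserving (swapOrigin i) (μH[(k : ℝ)]) (μH[(k : ℝ)]) :=
    ⟨he.continuous.measurable, hm.symm⟩
  have hpre : swapOrigin i ⁻¹' simplexFace k Finset.univ = simplexFace k Finset.univ := by
    ext x
    simp only [simplexFace, Set.mem_preimage, Set.mem_ofPred_eq, baryCoord_swapOrigin,
      Finset.mem_univ, not_true_eq_false, false_imp_iff, and_true]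
    exact (Equiv.swap (0 : Fin (k + 1)) i.succ).forall_congr_left.trans (by simp)
  rw [← hmp.setIntegral_preimage_emb he.measurableEmbedding, hpre]
  simp only [baryCoord_swapOrigin, Equiv.swap_apply_right]

theorem setIntegral_baryCoord_zero :
    ∫ x in simplexFace k Finset.univ, baryCoord x 0 ∂μH[(k : ℝ)] =
      (μH[(k : ℝ)] : Measure (EuclideanSpace ℝ (Fin k))).real (simplexFace k Finset.univ) /
        (k + 1) := by
  have hint : ∀ i : Fin (k + 1), IntegrableOn (fun x => baryCoord x i)
      (simplexFace k Finset.univ) μH[(k : ℝ)] := fun i =>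
    (continuous_baryCoord i).continuousOn.integrableOn_compact (isCompact_simplexFace _)
  have h : ∫ x in simplexFace k Finset.univ, ∑ i, baryCoord x i ∂μH[(k : ℝ)] =
      ∑ _i : Fin (k + 1), ∫ x in simplexFace k Finset.univ, baryCoord x 0 ∂μH[(k : ℝ)] := by
    rw [integral_finsetSum _ fun i _ => hint i]
    refine Finset.sum_congr rfl fun i _ => ?_
    refine Fin.cases rfl (fun j => ?_) i
    exact setIntegral_baryCoord_succ j
  simp only [sum_baryCoord, integral_const, MeasurableSet.univ, measureReal_restrict_apply,
    Set.univ_inter, smul_eq_mul, mul_one, Finset.sum_const, Finset.card_univ, Fintype.card_fin,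
    nsmul_eq_mul, Nat.cast_add, Nat.cast_one] at h
  rw [h]
  field_simp

theorem hausdorffMeasure_simplexFace_univ_pos :
    0 < (μH[(k : ℝ)] : Measure (EuclideanSpace ℝ (Fin k))).real (simplexFace k Finset.univ) := by
  refine ENNReal.toReal_pos ?_ (isCompact_simplexFace _).measure_lt_top.ne
  have hopen : IsOpen {x : EuclideanSpace ℝ (Fin k) | ∀ i, 0 < baryCoord x i} := by
    simp only [Set.ofPred_forall]
    exact isOpen_iInter_of_finite fun i =>
      isOpen_lt continuous_const (continuous_baryCoord i)
  have hne : {x : EuclideanSpace ℝ (Fin k) | ∀ i, 0 < baryCoord x i}.Nonempty := by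
    refine ⟨WithLp.toLp 2 fun _ => 1 / (k + 1), fun i => ?_⟩
    rw [baryCoord_toLp (w := fun _ => 1 / ((k : ℝ) + 1))]
    · positivity
    · simp
      field_simp
  refine ((hopen.measure_pos μH[(k : ℝ)] hne).trans_le (measure_mono ?_)).ne'
  intro x hx i
  exact ⟨(hx i).le, fun hi => absurd (Finset.mem_univ i) hi⟩

theorem hausdorffMeasure_restrict_simplexFace {N : ℕ} {s : Finset (Fin (N + 1))}
    (hs : s.card = k + 1) :
    ∃ p : Fin (k + 1) → Fin (N + 1), Function.Injective p ∧ Set.range p = s ∧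
      (0 ∈ s → p 0 = 0) ∧ Topology.IsClosedEmbedding (faceMap p) ∧
      (μH[(k : ℝ)] : Measure (EuclideanSpace ℝ (Fin N))).restrict (simplexFace N s) =
        ENNReal.ofReal (if 0 ∈ s then 1 else √(k + 1)) •
          Measure.map (faceMap p) (μH[(k : ℝ)].restrict (simplexFace k Finset.univ)) := by
  have hp : Function.Injective (s.orderEmbOfFin hs) := (s.orderEmbOfFin hs).injective
  have hr : Set.range (s.orderEmbOfFin hs) = s := s.range_orderEmbOfFin hs
  have hp0 : 0 ∈ s → s.orderEmbOfFin hs 0 = 0 := fun h0 => by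
    obtain ⟨i, hi⟩ : (0 : Fin (N + 1)) ∈ Set.range (s.orderEmbOfFin hs) := by
      rw [hr]; exact h0
    rw [← Fin.le_zero_iff, ← hi]
    exact (s.orderEmbOfFin hs).monotone (Fin.zero_le i)
  generalize (s.orderEmbOfFin hs : Fin (k + 1) → Fin (N + 1)) = p at *
  obtain ⟨c, hdet, hdist⟩ : ∃ c : ℝ,
      1 + k * c = (if 0 ∈ s then 1 else √(k + 1)) ∧
      ∀ x y, dist (faceMap p x) (faceMap p y) =
        dist (diagonalShear k c x) (diagonalShear k c y) := by
    by_cases h0 : 0 ∈ s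
    · refine ⟨0, by simp [h0], fun x y => ?_⟩
      rw [← sq_eq_sq₀ dist_nonneg dist_nonneg, dist_diagonalShear_sq]
      have h := dist_faceMap_sq hp x y
      rw [← hp0 h0, baryCoord_faceMap_apply hp, baryCoord_faceMap_apply hp] at h
      simp only [baryCoord_zero, Finset.sum_sub_distrib] at h ⊢
      linear_combination h
    · have hsq : √((k : ℝ) + 1) ^ 2 = k + 1 := Real.sq_sqrt (by positivity)
      have hnn := Real.sqrt_nonneg ((k : ℝ) + 1)
      refine ⟨1 / (√(k + 1) + 1), ?_, fun x y => ?_⟩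
      · rw [if_neg h0]
        field_simp
        linear_combination -hsq
      · rw [← sq_eq_sq₀ dist_nonneg dist_nonneg, dist_diagonalShear_sq]
        have h := dist_faceMap_sq hp x y
        have h0' : (0 : Fin (N + 1)) ∉ Set.range p := by rwa [hr]
        rw [baryCoord_faceMap_of_notMem hp _ h0', baryCoord_faceMap_of_notMem hp _ h0'] at h
        have hc : 2 * (1 / (√((k : ℝ) + 1) + 1)) + k * (1 / (√((k : ℝ) + 1) + 1)) ^ 2 = 1 := by
          field_simp
          linear_combination -hsq
        rw [hc]
        linear_combination h
  have hpos : (0 : ℝ) < if (0 : Fin (N + 1)) ∈ s then 1 else √(k + 1) := by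
    split_ifs <;> positivity
  obtain ⟨he, hm⟩ := hausdorffMeasure_restrict_range (faceMap p) (diagonalShear k c)
    (by rw [det_diagonalShear, hdet]; exact hpos.ne') hdist
  refine ⟨p, hp, hr, hp0, he, ?_⟩
  rw [det_diagonalShear, hdet, abs_of_pos hpos] at hm
  rw [← Set.inter_eq_left.2 (simplexFace_subset_range_faceMap hp hr),
    ← Measure.restrict_restrict (isCompact_simplexFace s).measurableSet, hm,
    Measure.restrict_smul, Measure.restrict_map he.continuous.measurable
    (isCompact_simplexFace s).measurableSet, faceMap_preimage_simplexFace hp hr]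

end Measure

section Skeleton

variable {N k : ℕ}

theorem aedisjoint_simplexFace {s t : Finset (Fin (N + 1))} (hs : s.card = k + 1)
    (ht : t.card = k + 1) (hst : s ≠ t) :
    AEDisjoint μH[(k : ℝ)] (simplexFace N s) (simplexFace N t) := by
  obtain ⟨i, his, hit⟩ : ∃ i ∈ s, i ∉ t := by
    by_contra! h
    exact hst (Finset.eq_of_subset_of_card_le h (by rw [hs, ht]))
  obtain ⟨p, hp, hr, -, he, hm⟩ := hausdorffMeasure_restrict_simplexFace (N := N) hs
  obtain ⟨a, rfl⟩ : i ∈ Set.range p := by rw [hr]; exact his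
  have hmeas : MeasurableSet (simplexFace N t) := (isCompact_simplexFace t).measurableSet
  have h0 : (μH[(k : ℝ)] : Measure (EuclideanSpace ℝ (Fin k))) (faceMap p ⁻¹' simplexFace N t) =
      0 := by
    refine measure_mono_null ?_ (hausdorffMeasure_baryCoord_eq_zero a)
    intro x hx
    have h := (hx (p a)).2 hit
    rwa [baryCoord_faceMap_apply hp] at h
  rw [AEDisjoint, Set.inter_comm, ← Measure.restrict_apply hmeas, hm, Measure.smul_apply,
    Measure.map_apply he.continuous.measurable hmeas,
    Measure.absolutelyContinuous_of_le Measure.restrict_le_self h0, smul_zero]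

theorem hausdorffMeasure_restrict_skeleton :
    (μH[(k : ℝ)] : Measure (EuclideanSpace ℝ (Fin N))).restrict (simplexSkeleton N k) =
      ∑ s : Finset.powersetCard (k + 1) (Finset.univ : Finset (Fin (N + 1))),
        μH[(k : ℝ)].restrict (simplexFace N (s : Finset (Fin (N + 1)))) := by
  rw [simplexSkeleton_eq_iUnion, Measure.restrict_iUnion_ae, Measure.sum_fintype]
  · intro s t hst
    exact aedisjoint_simplexFace (Finset.mem_powersetCard.1 s.2).2
      (Finset.mem_powersetCard.1 t.2).2 (fun h => hst (Subtype.ext h))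
  · exact fun s => (isCompact_simplexFace _).measurableSet.nullMeasurableSet

variable {E : Type*} [NormedAddCommGroup E]

theorem integrableOn_simplexFace {h : EuclideanSpace ℝ (Fin N) → E}
    (hc : Continuous h) {s : Finset (Fin (N + 1))} (hs : s.card = k + 1) :
    IntegrableOn h (simplexFace N s) μH[(k : ℝ)] := by
  obtain ⟨p, -, -, -, he, hm⟩ := hausdorffMeasure_restrict_simplexFace (N := N) hs
  rw [IntegrableOn, hm]
  refine Integrable.smul_measure ?_ ENNReal.ofReal_ne_top
  rw [he.measurableEmbedding.integrable_map_iff]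
  exact (hc.comp he.continuous).continuousOn.integrableOn_compact (isCompact_simplexFace _)

theorem integrableOn_simplexSkeleton {h : EuclideanSpace ℝ (Fin N) → E} (hc : Continuous h) :
    IntegrableOn h (simplexSkeleton N k) μH[(k : ℝ)] := by
  rw [IntegrableOn, hausdorffMeasure_restrict_skeleton, integrable_finsetSum_measure]
  exact fun s _ => integrableOn_simplexFace hc (Finset.mem_powersetCard.1 s.2).2

theorem setIntegral_simplexSkeleton {h : EuclideanSpace ℝ (Fin N) → ℝ} (hc : Continuous h) :
    ∫ x in simplexSkeleton N k, h x ∂μH[(k : ℝ)] =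
      ∑ s ∈ Finset.powersetCard (k + 1) (Finset.univ : Finset (Fin (N + 1))),
        ∫ x in simplexFace N s, h x ∂μH[(k : ℝ)] := by
  rw [hausdorffMeasure_restrict_skeleton, integral_finsetSum_measure, Finset.sum_coe_sort _
    fun s => ∫ x in simplexFace N s, h x ∂μH[(k : ℝ)]]
  exact fun s _ => integrableOn_simplexFace hc (Finset.mem_powersetCard.1 s.2).2

theorem setIntegral_simplexFace_one {s : Finset (Fin (N + 1))} (hs : s.card = k + 1) :
    ∫ _x in simplexFace N s, (1 : ℝ) ∂μH[(k : ℝ)] =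
      (if 0 ∈ s then 1 else √(k + 1)) *
        (μH[(k : ℝ)] : Measure (EuclideanSpace ℝ (Fin k))).real (simplexFace k Finset.univ) := by
  obtain ⟨p, hp, hr, -, he, hm⟩ := hausdorffMeasure_restrict_simplexFace (N := N) hs
  have hpos : (0 : ℝ) ≤ if (0 : Fin (N + 1)) ∈ s then 1 else √(k + 1) := by
    split_ifs <;> positivity
  rw [hm, integral_smul_measure, he.measurableEmbedding.integral_map,
    ENNReal.toReal_ofReal hpos]
  simp

theorem setIntegral_simplexFace_baryCoord_zero {s : Finset (Fin (N + 1))}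
    (hs : s.card = k + 1) :
    ∫ x in simplexFace N s, baryCoord x 0 ∂μH[(k : ℝ)] =
      if 0 ∈ s then
        (μH[(k : ℝ)] : Measure (EuclideanSpace ℝ (Fin k))).real (simplexFace k Finset.univ) /
          (k + 1)
      else 0 := by
  obtain ⟨p, hp, hr, hp0, he, hm⟩ := hausdorffMeasure_restrict_simplexFace (N := N) hs
  rw [hm, integral_smul_measure, he.measurableEmbedding.integral_map]
  by_cases h0 : 0 ∈ s
  · have h : ∀ x, baryCoord (faceMap p x) 0 = baryCoord x 0 := fun x => by
      rw [← baryCoord_faceMap_apply hp x 0, hp0 h0]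
    simp only [h, setIntegral_baryCoord_zero, if_pos h0]
    simp
  · have h : ∀ x, baryCoord (faceMap p x) 0 = 0 := fun x =>
      baryCoord_faceMap_of_notMem hp x (by rwa [hr])
    simp only [h, if_neg h0]
    simp

theorem sum_powersetCard_ite (u v : ℝ) :
    ∑ s ∈ Finset.powersetCard (k + 1) (Finset.univ : Finset (Fin (N + 1))),
      (if 0 ∈ s then u else v) = N.choose k * u + N.choose (k + 1) * v := by
  have h0 : (0 : Fin (N + 1)) ∉ (Finset.univ : Finset (Fin N)).map (Fin.succEmb N) := by
    simp [Fin.succ_ne_zero]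
  have hu : (Finset.univ : Finset (Fin (N + 1))) =
      insert 0 ((Finset.univ : Finset (Fin N)).map (Fin.succEmb N)) := by
    ext i
    refine Fin.cases ?_ (fun j => ?_) i <;> simp
  have hmem : ∀ {n : ℕ} {s}, s ∈ Finset.powersetCard n
      ((Finset.univ : Finset (Fin N)).map (Fin.succEmb N)) → (0 : Fin (N + 1)) ∉ s :=
    fun hs h => h0 ((Finset.mem_powersetCard.1 hs).1 h)
  rw [hu, Finset.powersetCard_succ_insert h0, Finset.sum_union, Finset.sum_image]
  · rw [Finset.sum_congr rfl fun s hs => if_neg (hmem hs)]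
    simp only [Finset.mem_insert_self, if_true, Finset.sum_const, Finset.card_powersetCard,
      Finset.card_map, Finset.card_univ, Fintype.card_fin, nsmul_eq_mul]
    ring
  · intro s hs t ht hst
    rw [← Finset.erase_insert (hmem hs), ← Finset.erase_insert (hmem ht), hst]
  · rw [Finset.disjoint_left]
    intro s hs hs'
    obtain ⟨t, -, rfl⟩ := Finset.mem_image.1 hs'
    exact hmem hs (Finset.mem_insert_self _ _)

theorem setIntegral_simplexSkeleton_swap (i j : Fin N) :
    ∫ x in simplexSkeleton N k, x i ∂μH[(k : ℝ)] =
      ∫ x in simplexSkeleton N k, x j ∂μH[(k : ℝ)] := by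
  set τ : Equiv.Perm (Fin (N + 1)) := Equiv.swap i.succ j.succ with hτ
  have hτ0 : τ 0 = 0 :=
    Equiv.swap_apply_of_ne_of_ne (Fin.succ_ne_zero i).symm (Fin.succ_ne_zero j).symm
  have hbary : ∀ x : EuclideanSpace ℝ (Fin N), ∀ m,
      baryCoord (faceMap τ x) m = baryCoord x (τ m) := fun x m => by
    rw [← baryCoord_faceMap_apply τ.injective x (τ m), hτ, Equiv.swap_apply_self]
  have hinv : Function.Involutive (faceMap τ : EuclideanSpace ℝ (Fin N) → _) := fun x =>
    baryCoord_injective (funext fun m => by rw [hbary, hbary, hτ, Equiv.swap_apply_self])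
  have hiso : Isometry (faceMap τ : EuclideanSpace ℝ (Fin N) → EuclideanSpace ℝ (Fin N)) :=
    Isometry.of_dist_eq fun x y => by
      rw [← sq_eq_sq₀ dist_nonneg dist_nonneg]
      have h := dist_faceMap_sq τ.injective x y
      rw [hbary, hbary, hτ0] at h
      simp only [baryCoord_zero, Finset.sum_sub_distrib] at h
      linear_combination h
  have hmp : MeasurePreserving (faceMap τ : EuclideanSpace ℝ (Fin N) → EuclideanSpace ℝ (Fin N))
      μH[(k : ℝ)] μH[(k : ℝ)] :=
    ⟨hiso.continuous.measurable, by
      rw [hiso.map_hausdorffMeasure (Or.inr hinv.surjective), hinv.surjective.range_eq,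
        Measure.restrict_univ]⟩
  have hmaps : ∀ x ∈ simplexSkeleton N k, faceMap τ x ∈ simplexSkeleton N k := by
    intro x hx
    rw [simplexSkeleton_eq_iUnion, Set.mem_iUnion] at hx ⊢
    obtain ⟨⟨s, hs⟩, hx⟩ := hx
    refine ⟨⟨s.map τ.toEmbedding, ?_⟩, fun m => ?_⟩
    · simpa using hs
    · rw [hbary]
      refine ⟨(hx _).1, fun hm => (hx _).2 fun hm' => hm ?_⟩
      exact Finset.mem_map.2 ⟨τ m, hm', Equiv.swap_apply_self _ _ _⟩
  have hpre : faceMap τ ⁻¹' simplexSkeleton N k = simplexSkeleton N k :=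
    subset_antisymm (fun x hx => by simpa only [hinv x] using hmaps _ hx) hmaps
  rw [← hmp.setIntegral_preimage_emb hiso.isClosedEmbedding.measurableEmbedding, hpre]
  have h : ∀ x : EuclideanSpace ℝ (Fin N), faceMap τ x i = x j := fun x => by
    rw [← baryCoord_succ, hbary, hτ, Equiv.swap_apply_left, baryCoord_succ]
  simp only [h]

theorem skeletonCentroid_apply (hk : k ≤ N) (i : Fin N) :
    N * skeletonCentroid N k i = 1 - 1 / ((k + 1) + (N - k) * √(k + 1)) := by
  set m := (μH[(k : ℝ)] : Measure (EuclideanSpace ℝ (Fin k))).real (simplexFace k Finset.univ)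
    with hm
  have hmpos : 0 < m := hausdorffMeasure_simplexFace_univ_pos
  have hcard : ∀ {s}, s ∈ Finset.powersetCard (k + 1) (Finset.univ : Finset (Fin (N + 1))) →
      s.card = k + 1 := fun hs => (Finset.mem_powersetCard.1 hs).2
  have hvol : (μH[(k : ℝ)] (simplexSkeleton N k)).toReal =
      N.choose k * m + N.choose (k + 1) * (√(k + 1) * m) := by
    have h := setIntegral_simplexSkeleton (N := N) (k := k)
      (continuous_const (y := (1 : ℝ)))
    rw [Finset.sum_congr rfl fun s hs => setIntegral_simplexFace_one (hcard hs)] at h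
    simp only [ite_mul, one_mul, ← hm] at h
    rw [sum_powersetCard_ite] at h
    rw [← h]
    simp [Measure.real]
  have hzero : ∫ x in simplexSkeleton N k, baryCoord x 0 ∂μH[(k : ℝ)] =
      N.choose k * (m / (k + 1)) := by
    rw [setIntegral_simplexSkeleton (continuous_baryCoord 0),
      Finset.sum_congr rfl fun s hs => setIntegral_simplexFace_baryCoord_zero (hcard hs),
      sum_powersetCard_ite, mul_zero, add_zero]
  have hcoord : ∀ j, (∫ x in simplexSkeleton N k, x ∂μH[(k : ℝ)]) j =
      ∫ x in simplexSkeleton N k, x i ∂μH[(k : ℝ)] := fun j => by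
    rw [setIntegral_simplexSkeleton_swap i j]
    exact ((EuclideanSpace.proj (𝕜 := ℝ) j).integral_comp_comm
      (integrableOn_simplexSkeleton continuous_id)).symm
  have hsum : (μH[(k : ℝ)] (simplexSkeleton N k)).toReal =
      ∫ x in simplexSkeleton N k, baryCoord x 0 ∂μH[(k : ℝ)] +
        N * ∫ x in simplexSkeleton N k, x i ∂μH[(k : ℝ)] := by
    have h : ∫ x in simplexSkeleton N k, ∑ l, baryCoord x l ∂μH[(k : ℝ)] = _ :=
      integral_finsetSum _ fun l _ => integrableOn_simplexSkeleton (continuous_baryCoord l)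
    simp only [Fin.sum_univ_succ (n := N), baryCoord_succ,
      fun j => setIntegral_simplexSkeleton_swap (k := k) j i] at h
    simp only [← baryCoord_succ, ← Fin.sum_univ_succ, sum_baryCoord] at h
    simpa [Measure.real] using h
  have hchoose : (N.choose (k + 1) : ℝ) * (k + 1) = N.choose k * (N - k) := by
    rw [← Nat.cast_sub hk]
    exact_mod_cast Nat.choose_succ_right_eq N k
  have hA : (0 : ℝ) < N.choose k := by exact_mod_cast Nat.choose_pos hk
  have hkN : (0 : ℝ) ≤ N - k := sub_nonneg.2 (by exact_mod_cast hk)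
  have hB : (N.choose (k + 1) : ℝ) = N.choose k * (N - k) / (k + 1) := by
    rw [← hchoose]
    field_simp
  have hsq : √((k : ℝ) + 1) ^ 2 = k + 1 := Real.sq_sqrt (by positivity)
  rw [skeletonCentroid, PiLp.smul_apply, smul_eq_mul, hcoord]
  rw [hzero] at hsum
  have hV : 0 < (μH[(k : ℝ)] (simplexSkeleton N k)).toReal := by
    rw [hvol]
    positivity
  have hI : N * ∫ x in simplexSkeleton N k, x i ∂μH[(k : ℝ)] =
      (μH[(k : ℝ)] (simplexSkeleton N k)).toReal - N.choose k * (m / (k + 1)) := by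
    rw [hsum]; ring
  rw [mul_left_comm, hI, mul_sub, inv_mul_cancel₀ hV.ne', hvol, hB]
  have hD : 0 < (k : ℝ) + 1 + (N - k) * √(k + 1) := by positivity
  field_simp

end Skeleton

theorem isSquare_of_sqrt_mul_sub_add {p q : ℕ} {m : ℤ} (hp : 1 < p) (hq : 1 < q)
    (h : √(p : ℝ) * √q - (√p + √q) = m) : IsSquare p ∧ IsSquare q := by
  have hs : √(p : ℝ) ^ 2 = p := Real.sq_sqrt p.cast_nonneg
  have ht : √(q : ℝ) ^ 2 = q := Real.sq_sqrt q.cast_nonneg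
  have hs1 : 1 < √(p : ℝ) := Real.lt_sqrt_of_sq_lt (by simpa using hp)
  have ht1 : 1 < √(q : ℝ) := Real.lt_sqrt_of_sq_lt (by simpa using hq)
  generalize hS : √(p : ℝ) = s at *
  generalize hT : √(q : ℝ) = t at *
  have hm : 0 < (m : ℝ) + 1 := by nlinarith
  have hst : s * t = (p * q + m ^ 2 - p - q) / (2 * (m + 1)) := by
    rw [eq_div_iff (by positivity), ← h, ← hs, ← ht]
    ring
  have hadd : s + t = (p * q + m ^ 2 - p - q) / (2 * (m + 1)) - m := by
    rw [← hst]; linear_combination -h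
  have hsub : t - s = (q - p) / (s + t) := by
    rw [eq_div_iff (by positivity), ← hs, ← ht]
    ring
  have hrat : ∃ u v : ℚ, s = u ∧ t = v := by
    set w : ℚ := (p * q + m ^ 2 - p - q) / (2 * (m + 1)) - m with hw
    have hw' : s + t = (w : ℝ) := by rw [hadd, hw]; push_cast; ring
    rw [hw'] at hsub
    refine ⟨(w - (q - p) / w) / 2, (w + (q - p) / w) / 2, ?_, ?_⟩
    · push_cast
      linear_combination (hw' - hsub) / 2
    · push_cast
      linear_combination (hw' + hsub) / 2
  obtain ⟨u, v, hu, hv⟩ := hrat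
  constructor <;> by_contra hn
  · exact irrational_sqrt_natCast_iff.2 hn ⟨u, by rw [hS, hu]⟩
  · exact irrational_sqrt_natCast_iff.2 hn ⟨v, by rw [hT, hv]⟩

theorem skeletonCentroid_eq_iff {N k₁ k₂ : ℕ} (hN : 0 < N) (h₁₂ : k₁ < k₂) (hk₂ : k₂ ≤ N) :
    skeletonCentroid N k₁ = skeletonCentroid N k₂ ↔
      √((k₁ + 1 : ℕ) : ℝ) * √((k₂ + 1 : ℕ) : ℝ) -
        (√((k₁ + 1 : ℕ) : ℝ) + √((k₂ + 1 : ℕ) : ℝ)) = ((N - 1 - k₁ - k₂ : ℤ) : ℝ) := by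
  have hk₁ : k₁ ≤ N := h₁₂.le.trans hk₂
  have hN' : (N : ℝ) ≠ 0 := by exact_mod_cast hN.ne'
  have hcoord : skeletonCentroid N k₁ = skeletonCentroid N k₂ ↔
      ((k₁ : ℝ) + 1) + (N - k₁) * √(k₁ + 1) = (k₂ + 1) + (N - k₂) * √(k₂ + 1) := by
    constructor
    · intro h
      have h1 := skeletonCentroid_apply hk₁ ⟨0, hN⟩
      rw [h, skeletonCentroid_apply hk₂, sub_right_inj, one_div, one_div, inv_inj] at h1
      exact h1.symm
    · intro h
      ext i
      refine mul_left_cancel₀ hN' ?_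
      rw [skeletonCentroid_apply hk₁, skeletonCentroid_apply hk₂, h]
  have hs : √((k₁ : ℝ) + 1) ^ 2 = k₁ + 1 := Real.sq_sqrt (by positivity)
  have ht : √((k₂ : ℝ) + 1) ^ 2 = k₂ + 1 := Real.sq_sqrt (by positivity)
  have hlt : √((k₁ : ℝ) + 1) < √((k₂ : ℝ) + 1) :=
    Real.sqrt_lt_sqrt (by positivity) (by gcongr)
  rw [hcoord]
  push_cast
  generalize √((k₁ : ℝ) + 1) = s at *
  generalize √((k₂ : ℝ) + 1) = t at *
  have hk₁' : (k₁ : ℝ) = s ^ 2 - 1 := by linarith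
  have hk₂' : (k₂ : ℝ) = t ^ 2 - 1 := by linarith
  rw [hk₁', hk₂', ← sub_eq_zero,
    show s ^ 2 - 1 + 1 + (N - (s ^ 2 - 1)) * s - (t ^ 2 - 1 + 1 + (N - (t ^ 2 - 1)) * t) =
      (t - s) * (s * t - (s + t) - (N - 1 - (s ^ 2 - 1) - (t ^ 2 - 1))) by ring,
    mul_eq_zero, or_iff_right (sub_pos.2 hlt).ne', sub_eq_zero]

/-- Fix `N ≥ 2` and `1 ≤ k₁ < k₂ ≤ N - 1`.  The centroids of the `k₁`- and `k₂`-skeletons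
of the standard simplex in `ℝ^N` are equal if and only if there are positive integers
`a`, `b` with `k₁ = a² - 1`, `k₂ = b² - 1` and `N = (b² + ab + a²) - (b + a) - 1`. -/
theorem centroid_eq_iff (N k₁ k₂ : ℕ) (hN : 2 ≤ N) (hk₁ : 1 ≤ k₁) (h₁₂ : k₁ < k₂)
    (hk₂ : k₂ ≤ N - 1) :
    skeletonCentroid N k₁ = skeletonCentroid N k₂ ↔
      ∃ a b : ℕ, 0 < a ∧ 0 < b ∧ k₁ + 1 = a ^ 2 ∧ k₂ + 1 = b ^ 2 ∧
        N + (b + a) + 1 = b ^ 2 + a * b + a ^ 2 := by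
  rw [skeletonCentroid_eq_iff (by omega) h₁₂ (by omega)]
  have key : ∀ a b : ℕ, k₁ + 1 = a ^ 2 → k₂ + 1 = b ^ 2 →
      (√((k₁ + 1 : ℕ) : ℝ) * √((k₂ + 1 : ℕ) : ℝ) -
        (√((k₁ + 1 : ℕ) : ℝ) + √((k₂ + 1 : ℕ) : ℝ)) = ((N - 1 - k₁ - k₂ : ℤ) : ℝ) ↔
        N + (b + a) + 1 = b ^ 2 + a * b + a ^ 2) := by
    intro a b ha hb
    have ha' : (k₁ : ℤ) + 1 = a ^ 2 := by exact_mod_cast ha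
    have hb' : (k₂ : ℤ) + 1 = b ^ 2 := by exact_mod_cast hb
    rw [ha, hb, Nat.cast_pow, Nat.cast_pow, Real.sqrt_sq a.cast_nonneg,
      Real.sqrt_sq b.cast_nonneg]
    have hcast : ((a : ℝ) * b - (a + b) = ((N - 1 - k₁ - k₂ : ℤ) : ℝ)) ↔
        ((a : ℤ) * b - (a + b) = N - 1 - k₁ - k₂) := by
      norm_cast
    rw [hcast]
    zify
    constructor <;> intro h <;> linarith
  constructor
  · intro h
    obtain ⟨⟨a, ha⟩, ⟨b, hb⟩⟩ := isSquare_of_sqrt_mul_sub_add (by omega) (by omega) h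
    rw [← sq] at ha hb
    exact ⟨a, b, Nat.pos_of_ne_zero (by rintro rfl; simp at ha),
      Nat.pos_of_ne_zero (by rintro rfl; simp at hb), ha, hb, (key a b ha hb).1 h⟩
  · rintro ⟨a, b, -, -, ha, hb, h⟩
    exact (key a b ha hb).2 h
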